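/- arXiv:2112.10533 — 2 statements merged into one kernel-verified Lean document; each statement's English description precedes it below -/
import Mathlib

section
/- Let f ∈ ℝ[x,y,z] be a smooth psd ternary quartic. Then f has an automorphism of order 2 if and only if there exist four pairwise non-proportional bitangents l₁, l₂, l₃, l₄ of f and a nonzero point P ∈ ℂ³ with l₁(P) = l₂(P) = l₃(P) = l₄(P) = 0, i.e., four different bitangents of f intersect in a common point. -/
open MvPolynomial Matrix

/-- `f` is smooth: no nonzero complex point at which all partial derivatives of the
complexification of `f` vanish. -/
def IsSmooth (f : MvPolynomial (Fin 3) ℝ) : Prop :=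
  ∀ a : Fin 3 → ℂ,
    (∀ i, eval a (pderiv i (map (algebraMap ℝ ℂ) f)) = 0) → a = 0

/-- `f` is positive semidefinite on `ℝ³`. -/
def IsPsd (f : MvPolynomial (Fin 3) ℝ) : Prop :=
  ∀ a : Fin 3 → ℝ, 0 ≤ eval a f

/-- `f` has an automorphism of order 2: an `A ∈ GL₃(ℂ)`, not a scalar multiple of
the identity, whose square is a scalar multiple of the identity, such that the
complexification of `f` satisfies `f(A·(x,y,z)ᵀ) = f(x,y,z)`. -/
def HasOrder2Aut (f : MvPolynomial (Fin 3) ℝ) : Prop :=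
  ∃ A : Matrix (Fin 3) (Fin 3) ℂ, IsUnit A.det ∧
    (¬ ∃ c : ℂ, A = c • (1 : Matrix (Fin 3) (Fin 3) ℂ)) ∧
    (∃ c : ℂ, A * A = c • (1 : Matrix (Fin 3) (Fin 3) ℂ)) ∧
    aeval (fun i => ∑ j, MvPolynomial.C (A i j) * X j) (map (algebraMap ℝ ℂ) f)
      = map (algebraMap ℝ ℂ) f

/-- A bitangent of `f`: a nonzero complex linear form `l` such that
`f = q² + h·l` for some forms `q` of degree 2 and `h` of degree 3. -/
def IsBitangent (f : MvPolynomial (Fin 3) ℝ) (l : MvPolynomial (Fin 3) ℂ) : Prop :=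
  l ≠ 0 ∧ l.IsHomogeneous 1 ∧ ∃ q h : MvPolynomial (Fin 3) ℂ,
    q.IsHomogeneous 2 ∧ h.IsHomogeneous 3 ∧
    map (algebraMap ℝ ℂ) f = q ^ 2 + h * l

theorem homog_expand (n : ℕ) (g : MvPolynomial (Fin 3) ℂ) (hg : g.IsHomogeneous n) :
    ∃ c : (Fin 3 → ℕ) → ℂ, g = ∑ t ∈ Finset.Nat.antidiagonalTuple 3 n,
      C (c t) * (X 0 ^ t 0 * X 1 ^ t 1 * X 2 ^ t 2) := by
  refine ⟨fun t => coeff (Finsupp.equivFunOnFinite.symm t) g, ?_⟩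
  have h1 : g = ∑ t ∈ Finset.Nat.antidiagonalTuple 3 n,
      monomial (Finsupp.equivFunOnFinite.symm t) (coeff (Finsupp.equivFunOnFinite.symm t) g) := by
    conv_lhs => rw [g.as_sum]
    refine Finset.sum_bij_ne_zero (fun d _ _ => (d : Fin 3 → ℕ)) ?_ ?_ ?_ ?_
    · intro d hd _
      rw [Finset.Nat.mem_antidiagonalTuple]
      have := hg (mem_support_iff.1 hd)
      rw [← this, Finsupp.weight_apply, Finsupp.sum_fintype] <;> simp
    · intro a _ _ b _ _ h
      exact DFunLike.coe_injective h
    · intro t ht h0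
      refine ⟨Finsupp.equivFunOnFinite.symm t, ?_, ?_, ?_⟩
      · rw [mem_support_iff]; intro h; simp [h] at h0
      · exact h0
      · simp
    · intro d _ _
      have : Finsupp.equivFunOnFinite.symm (d : Fin 3 → ℕ) = d := by ext; simp
      rw [this]
  conv_lhs => rw [h1]
  refine Finset.sum_congr rfl fun t _ => ?_
  rw [monomial_eq, Finsupp.prod_fintype _ _ (by simp)]
  simp [Fin.prod_univ_three]

theorem anti4 : Finset.Nat.antidiagonalTuple 3 4 = {![4,0,0],![3,1,0],![3,0,1],![2,2,0],![2,1,1],![2,0,2],![1,3,0],![1,2,1],![1,1,2],![1,0,3],![0,4,0],![0,3,1],![0,2,2],![0,1,3],![0,0,4]} := by decide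

theorem anti2 : Finset.Nat.antidiagonalTuple 3 2 = {![2,0,0],![1,1,0],![1,0,1],![0,2,0],![0,1,1],![0,0,2]} := by decide
theorem anti1 : Finset.Nat.antidiagonalTuple 3 1 = {![1,0,0],![0,1,0],![0,0,1]} := by decide

/-- General ternary quartic. -/
noncomputable def quart (a b1 b2 c1 c2 c3 d1 d2 d3 d4 e1 e2 e3 e4 e5 : ℂ) : MvPolynomial (Fin 3) ℂ :=
  C a * X 0 ^ 4 + (C b1 * X 1 + C b2 * X 2) * X 0 ^ 3
   + (C c1 * X 1 ^ 2 + C c2 * (X 1 * X 2) + C c3 * X 2 ^ 2) * X 0 ^ 2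
   + (C d1 * X 1 ^ 3 + C d2 * (X 1 ^ 2 * X 2) + C d3 * (X 1 * X 2 ^ 2) + C d4 * X 2 ^ 3) * X 0
   + (C e1 * X 1 ^ 4 + C e2 * (X 1 ^ 3 * X 2) + C e3 * (X 1 ^ 2 * X 2 ^ 2)
      + C e4 * (X 1 * X 2 ^ 3) + C e5 * X 2 ^ 4)

theorem exists_quart (g : MvPolynomial (Fin 3) ℂ) (hg : g.IsHomogeneous 4) :
    ∃ a b1 b2 c1 c2 c3 d1 d2 d3 d4 e1 e2 e3 e4 e5 : ℂ,
      g = quart a b1 b2 c1 c2 c3 d1 d2 d3 d4 e1 e2 e3 e4 e5 := by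
  obtain ⟨c, h⟩ := homog_expand 4 g hg
  refine ⟨c ![4,0,0], c ![3,1,0], c ![3,0,1], c ![2,2,0], c ![2,1,1], c ![2,0,2], c ![1,3,0],
    c ![1,2,1], c ![1,1,2], c ![1,0,3], c ![0,4,0], c ![0,3,1], c ![0,2,2], c ![0,1,3],
    c ![0,0,4], ?_⟩
  rw [h, anti4]
  iterate 14 rw [Finset.sum_insert (by decide)]
  rw [Finset.sum_singleton]
  simp [quart]
  ring

theorem exists_quad (g : MvPolynomial (Fin 3) ℂ) (hg : g.IsHomogeneous 2) :
    ∃ a b1 b2 c1 c2 c3 : ℂ, g = C a * X 0 ^ 2 + (C b1 * X 1 + C b2 * X 2) * X 0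
      + (C c1 * X 1 ^ 2 + C c2 * (X 1 * X 2) + C c3 * X 2 ^ 2) := by
  obtain ⟨c, h⟩ := homog_expand 2 g hg
  refine ⟨c ![2,0,0], c ![1,1,0], c ![1,0,1], c ![0,2,0], c ![0,1,1], c ![0,0,2], ?_⟩
  rw [h, anti2]
  iterate 5 rw [Finset.sum_insert (by decide)]
  rw [Finset.sum_singleton]
  simp
  ring

theorem exists_lin (g : MvPolynomial (Fin 3) ℂ) (hg : g.IsHomogeneous 1) :
    ∃ a b c : ℂ, g = C a * X 0 + C b * X 1 + C c * X 2 := by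
  obtain ⟨c, h⟩ := homog_expand 1 g hg
  refine ⟨c ![1,0,0], c ![0,1,0], c ![0,0,1], ?_⟩
  rw [h, anti1]
  iterate 2 rw [Finset.sum_insert (by decide)]
  rw [Finset.sum_singleton]
  simp
  ring

/-- Linear substitution. -/
noncomputable def lsub (M : Matrix (Fin 3) (Fin 3) ℂ) :
    MvPolynomial (Fin 3) ℂ →ₐ[ℂ] MvPolynomial (Fin 3) ℂ :=
  aeval (fun i => ∑ j, MvPolynomial.C (M i j) * X j)

theorem lsub_X (M : Matrix (Fin 3) (Fin 3) ℂ) (i : Fin 3) :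
    lsub M (X i) = ∑ j, C (M i j) * X j := by simp [lsub]

theorem lsub_C (M : Matrix (Fin 3) (Fin 3) ℂ) (c : ℂ) :
    lsub M (C c) = C c := by simp [lsub]

theorem eval_lsub (M : Matrix (Fin 3) (Fin 3) ℂ) (a : Fin 3 → ℂ) (g : MvPolynomial (Fin 3) ℂ) :
    eval a (lsub M g) = eval (M *ᵥ a) g := by
  induction g using MvPolynomial.induction_on with
  | C c => simp
  | add p q hp hq => simp [hp, hq]
  | mul_X p i hp =>
    rw [map_mul, map_mul, hp, lsub_X, map_mul]
    simp [Matrix.mulVec, dotProduct]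

theorem lsub_lsub (M N : Matrix (Fin 3) (Fin 3) ℂ) (g : MvPolynomial (Fin 3) ℂ) :
    lsub M (lsub N g) = lsub (N * M) g := by
  apply MvPolynomial.funext
  intro a
  rw [eval_lsub, eval_lsub, eval_lsub, Matrix.mulVec_mulVec]

theorem lsub_one (g : MvPolynomial (Fin 3) ℂ) : lsub 1 g = g := by
  apply MvPolynomial.funext
  intro a
  rw [eval_lsub, Matrix.one_mulVec]

theorem lsub_homog (M : Matrix (Fin 3) (Fin 3) ℂ) (n : ℕ) (g : MvPolynomial (Fin 3) ℂ)
    (hg : g.IsHomogeneous n) : (lsub M g).IsHomogeneous n := by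
  have := hg.aeval (fun i => ∑ j, MvPolynomial.C (M i j) * X j) (n := 1) (fun i =>
    IsHomogeneous.sum _ _ _ fun j _ => by
      simpa using (isHomogeneous_C (Fin 3) (M i j)).mul (isHomogeneous_X ℂ j))
  simpa [lsub] using this

theorem lsub_scalar (c : ℂ) (g : MvPolynomial (Fin 3) ℂ)
    (hg : g.IsHomogeneous 4) : lsub (c • 1) g = C (c ^ 4) * g := by
  apply MvPolynomial.funext
  intro a
  rw [eval_lsub, Matrix.smul_mulVec, Matrix.one_mulVec]
  obtain ⟨a, b1, b2, c1, c2, c3, d1, d2, d3, d4, e1, e2, e3, e4, e5, rfl⟩ := exists_quart g hg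
  simp [quart]
  ring

theorem pderiv_lsub (M : Matrix (Fin 3) (Fin 3) ℂ) (i : Fin 3) (g : MvPolynomial (Fin 3) ℂ) :
    pderiv i (lsub M g) = ∑ k, C (M k i) * lsub M (pderiv k g) := by
  induction g using MvPolynomial.induction_on with
  | C c => simp
  | add p q hp hq => simp [hp, hq, mul_add, Finset.sum_add_distrib]
  | mul_X p j hp =>
    have h : pderiv i (lsub M (X j)) = C (M j i) := by
      rw [lsub_X, map_sum]
      simp [pderiv_X, Pi.single_apply]
    rw [map_mul, Derivation.leibniz, hp, h]
    have h' : ∀ k, pderiv k (p * X j) = p * pderiv k (X j) + X j * pderiv k p := by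
      intro k; rw [Derivation.leibniz]; rfl
    simp only [h', map_add, pderiv_X, smul_eq_mul, map_mul, mul_add,
      Finset.sum_add_distrib, Finset.mul_sum]
    refine congrArg₂ (fun a b => a + b) ?_ ?_
    · rw [Finset.sum_eq_single j]
      · simp; ring
      · intro b _ hb; simp [Pi.single_apply, hb.symm]
      · simp
    · refine Finset.sum_congr rfl fun k _ => by ring

/-- Smoothness over the complex numbers. -/
def CSmooth (g : MvPolynomial (Fin 3) ℂ) : Prop :=
  ∀ a : Fin 3 → ℂ, (∀ i, eval a (pderiv i g) = 0) → a = 0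

theorem CSmooth.lsub {g : MvPolynomial (Fin 3) ℂ} (hg : CSmooth g)
    {M N : Matrix (Fin 3) (Fin 3) ℂ} (hNM : N * M = 1) : CSmooth (lsub M g) := by
  have hMN : M * N = 1 := mul_eq_one_comm.1 hNM
  intro a ha
  have h1 : (fun k => eval (M *ᵥ a) (pderiv k g)) ᵥ* M = 0 := by
    ext i
    have := ha i
    rw [pderiv_lsub] at this
    simp [eval_lsub] at this
    simp [Matrix.vecMul, dotProduct]
    rw [← this]
    exact Finset.sum_congr rfl fun k _ => mul_comm _ _
  have h2 : (fun k => eval (M *ᵥ a) (pderiv k g)) = 0 := by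
    have := congrArg (fun v => v ᵥ* N) h1
    simpa [Matrix.vecMul_vecMul, hMN] using this
  have h3 := hg (M *ᵥ a) (fun i => congrFun h2 i)
  have := congrArg (fun v => N *ᵥ v) h3
  simpa [Matrix.mulVec_mulVec, hNM] using this

/-- Complex bitangent. -/
def CBit (g l : MvPolynomial (Fin 3) ℂ) : Prop :=
  l ≠ 0 ∧ l.IsHomogeneous 1 ∧ ∃ q h : MvPolynomial (Fin 3) ℂ,
    q.IsHomogeneous 2 ∧ h.IsHomogeneous 3 ∧ g = q ^ 2 + h * l

theorem lsub_inv {M N : Matrix (Fin 3) (Fin 3) ℂ} (h : N * M = 1) (g : MvPolynomial (Fin 3) ℂ) :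
    lsub M (lsub N g) = g := by rw [lsub_lsub, h, lsub_one]

theorem CBit.lsub {g l : MvPolynomial (Fin 3) ℂ} (hg : CBit g l)
    {M N : Matrix (Fin 3) (Fin 3) ℂ} (hNM : N * M = 1) : CBit (lsub M g) (lsub M l) := by
  have hMN : M * N = 1 := mul_eq_one_comm.1 hNM
  obtain ⟨h0, h1, q, h, hq, hh, e⟩ := hg
  refine ⟨?_, lsub_homog _ _ _ h1, _root_.lsub M q, _root_.lsub M h, lsub_homog _ _ _ hq,
    lsub_homog _ _ _ hh, ?_⟩
  · intro h
    apply h0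
    rw [← lsub_inv hMN l, h, map_zero]
  · rw [e]; simp

/-- Four concurrent bitangents. -/
def CFour (g : MvPolynomial (Fin 3) ℂ) : Prop :=
  ∃ l : Fin 4 → MvPolynomial (Fin 3) ℂ,
        (∀ i, CBit g (l i)) ∧
        (∀ i j, i ≠ j → ¬ ∃ c : ℂ, l i = c • l j) ∧
        ∃ P : Fin 3 → ℂ, P ≠ 0 ∧ ∀ i, eval P (l i) = 0

theorem CFour.lsub {g : MvPolynomial (Fin 3) ℂ} (hg : CFour g)
    {M N : Matrix (Fin 3) (Fin 3) ℂ} (hNM : N * M = 1) : CFour (lsub M g) := by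
  have hMN : M * N = 1 := mul_eq_one_comm.1 hNM
  obtain ⟨l, hl, hne, P, hP, h0⟩ := hg
  refine ⟨fun i => _root_.lsub M (l i), fun i => (hl i).lsub hNM, ?_, N *ᵥ P, ?_, ?_⟩
  · rintro i j hij ⟨c, hc⟩
    refine hne i j hij ⟨c, ?_⟩
    have hc' : _root_.lsub M (l i) = c • _root_.lsub M (l j) := hc
    rw [← lsub_inv hMN (l i), hc', map_smul, lsub_inv hMN]
  · intro h
    apply hP
    have := congrArg (fun v => M *ᵥ v) h
    simpa [Matrix.mulVec_mulVec, hMN] using this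
  · intro i
    rw [eval_lsub, Matrix.mulVec_mulVec, hMN, Matrix.one_mulVec, h0]

/-- Complex order two automorphism. -/
def CAut (g : MvPolynomial (Fin 3) ℂ) : Prop :=
  ∃ A : Matrix (Fin 3) (Fin 3) ℂ, IsUnit A.det ∧
    (¬ ∃ c : ℂ, A = c • (1 : Matrix (Fin 3) (Fin 3) ℂ)) ∧
    (∃ c : ℂ, A * A = c • (1 : Matrix (Fin 3) (Fin 3) ℂ)) ∧ lsub A g = g

theorem CAut.lsub {g : MvPolynomial (Fin 3) ℂ} (hg : CAut g)
    {M N : Matrix (Fin 3) (Fin 3) ℂ} (hNM : N * M = 1) : CAut (lsub M g) := by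
  have hMN : M * N = 1 := mul_eq_one_comm.1 hNM
  obtain ⟨A, hA, hs, ⟨c, hc⟩, hf⟩ := hg
  refine ⟨N * A * M, ?_, ?_, ⟨c, ?_⟩, ?_⟩
  · have : N.det * M.det = 1 := by rw [← Matrix.det_mul, hNM, Matrix.det_one]
    rw [Matrix.det_mul, Matrix.det_mul, mul_right_comm, this, one_mul]; exact hA
  · rintro ⟨d, hd⟩
    refine hs ⟨d, ?_⟩
    have : M * (N * A * M) * N = A := by
      rw [← mul_assoc, ← mul_assoc, hMN, one_mul, mul_assoc, hMN, mul_one]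
    rw [← this, hd]; simp [hMN]
  · calc N * A * M * (N * A * M) = N * A * (M * N) * A * M := by simp only [mul_assoc]
      _ = N * (A * A) * M := by rw [hMN, mul_one]; simp only [mul_assoc]
      _ = _ := by rw [hc]; simp [hNM]
  · rw [lsub_lsub, ← mul_assoc, ← mul_assoc, hMN, one_mul, ← lsub_lsub, hf]

/-- A basis adapted to a vector and a hyperplane not containing it. -/
theorem exists_frame (u v : Fin 3 → ℂ) (h : v ⬝ᵥ u ≠ 0) :
    ∃ M N : Matrix (Fin 3) (Fin 3) ℂ, N * M = 1 ∧ M *ᵥ ![1,0,0] = u ∧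
      v ⬝ᵥ (M *ᵥ ![0,1,0]) = 0 ∧ v ⬝ᵥ (M *ᵥ ![0,0,1]) = 0 := by
  suffices H : ∃ M : Matrix (Fin 3) (Fin 3) ℂ, M.det ≠ 0 ∧ M *ᵥ ![1,0,0] = u ∧
      v ⬝ᵥ (M *ᵥ ![0,1,0]) = 0 ∧ v ⬝ᵥ (M *ᵥ ![0,0,1]) = 0 by
    obtain ⟨M, h1, h2⟩ := H
    exact ⟨M, M⁻¹, Matrix.nonsing_inv_mul M (isUnit_iff_ne_zero.2 h1), h2⟩
  rw [dotProduct, Fin.sum_univ_three] at h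
  have hv : v 0 ≠ 0 ∨ v 1 ≠ 0 ∨ v 2 ≠ 0 := by
    by_contra! hh
    apply h; simp [hh.1, hh.2.1, hh.2.2]
  rcases hv with hv | hv | hv
  · refine ⟨!![u 0, -v 1, -v 2; u 1, v 0, 0; u 2, 0, v 0], ?_, ?_, ?_, ?_⟩
    · rw [Matrix.det_fin_three]
      simp
      intro h0
      apply mul_ne_zero hv h
      linear_combination h0
    · ext i; fin_cases i <;> simp [Matrix.mulVec, dotProduct, Fin.sum_univ_three]
    · simp [Matrix.mulVec, dotProduct, Fin.sum_univ_three]; ring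
    · simp [Matrix.mulVec, dotProduct, Fin.sum_univ_three]; ring
  · refine ⟨!![u 0, v 1, 0; u 1, -v 0, -v 2; u 2, 0, v 1], ?_, ?_, ?_, ?_⟩
    · rw [Matrix.det_fin_three]
      simp
      intro h0
      apply mul_ne_zero hv h
      linear_combination -h0
    · ext i; fin_cases i <;> simp [Matrix.mulVec, dotProduct, Fin.sum_univ_three]
    · simp [Matrix.mulVec, dotProduct, Fin.sum_univ_three]; ring
    · simp [Matrix.mulVec, dotProduct, Fin.sum_univ_three]; ring
  · refine ⟨!![u 0, v 2, 0; u 1, 0, v 2; u 2, -v 0, -v 1], ?_, ?_, ?_, ?_⟩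
    · rw [Matrix.det_fin_three]
      simp
      intro h0
      apply mul_ne_zero hv h
      linear_combination h0
    · ext i; fin_cases i <;> simp [Matrix.mulVec, dotProduct, Fin.sum_univ_three]
    · simp [Matrix.mulVec, dotProduct, Fin.sum_univ_three]; ring
    · simp [Matrix.mulVec, dotProduct, Fin.sum_univ_three]; ring

theorem coef_zero (k4 k3 k2 k1 k0 : ℂ)
    (h : ∀ x : ℂ, k4 * x ^ 4 + k3 * x ^ 3 + k2 * x ^ 2 + k1 * x + k0 = 0) :
    k4 = 0 ∧ k3 = 0 ∧ k2 = 0 ∧ k1 = 0 := by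
  have h0 := h 0
  have h1 := h 1
  have h2 := h (-1)
  have h3 := h 2
  have h4 := h (-2)
  refine ⟨?_, ?_, ?_, ?_⟩
  · linear_combination (1/4) * h0 - (1/6) * h1 - (1/6) * h2 + (1/24) * h3 + (1/24) * h4
  · linear_combination (-1/6) * h1 + (1/6) * h2 + (1/12) * h3 - (1/12) * h4
  · linear_combination (-5/4) * h0 + (2/3) * h1 + (2/3) * h2 - (1/24) * h3 - (1/24) * h4
  · linear_combination (2/3) * h1 - (2/3) * h2 - (1/12) * h3 + (1/12) * h4

theorem line_coeffs (a b1 b2 c1 c2 c3 d1 d2 d3 d4 e1 e2 e3 e4 e5 β γ : ℂ)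
    (h : CBit (quart a b1 b2 c1 c2 c3 d1 d2 d3 d4 e1 e2 e3 e4 e5) (C β * X 1 + C γ * X 2)) :
    ∃ q0 q1 q2 : ℂ, a = q0 ^ 2 ∧ b1 * γ + b2 * (-β) = 2 * q0 * q1 ∧
      c1 * γ ^ 2 + c2 * (γ * (-β)) + c3 * (-β) ^ 2 = q1 ^ 2 + 2 * q0 * q2 ∧
      d1 * γ ^ 3 + d2 * (γ ^ 2 * (-β)) + d3 * (γ * (-β) ^ 2) + d4 * (-β) ^ 3 = 2 * q1 * q2 := by
  obtain ⟨-, -, q, h, hq, -, e⟩ := h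
  obtain ⟨r, s1, s2, t1, t2, t3, rfl⟩ := exists_quad q hq
  refine ⟨r, s1 * γ + s2 * (-β), t1 * γ ^ 2 + t2 * (γ * (-β)) + t3 * (-β) ^ 2, ?_⟩
  have key := coef_zero
    (a - r ^ 2) (b1 * γ + b2 * (-β) - 2 * r * (s1 * γ + s2 * (-β)))
    (c1 * γ ^ 2 + c2 * (γ * (-β)) + c3 * (-β) ^ 2 - ((s1 * γ + s2 * (-β)) ^ 2
      + 2 * r * (t1 * γ ^ 2 + t2 * (γ * (-β)) + t3 * (-β) ^ 2)))
    (d1 * γ ^ 3 + d2 * (γ ^ 2 * (-β)) + d3 * (γ * (-β) ^ 2) + d4 * (-β) ^ 3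
      - 2 * (s1 * γ + s2 * (-β)) * (t1 * γ ^ 2 + t2 * (γ * (-β)) + t3 * (-β) ^ 2))
    (e1 * γ ^ 4 + e2 * (γ ^ 3 * (-β)) + e3 * (γ ^ 2 * (-β) ^ 2) + e4 * (γ * (-β) ^ 3)
      + e5 * (-β) ^ 4 - (t1 * γ ^ 2 + t2 * (γ * (-β)) + t3 * (-β) ^ 2) ^ 2) (by
      intro x
      have := congrArg (eval ![x, γ, -β]) e
      simp only [quart, map_add, map_mul, map_pow, eval_C, eval_X, Matrix.cons_val_zero,
        Matrix.cons_val_one, Matrix.cons_val] at this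
      linear_combination this)
  obtain ⟨k4, k3, k2, k1⟩ := key
  exact ⟨sub_eq_zero.1 k4, sub_eq_zero.1 k3, sub_eq_zero.1 k2, sub_eq_zero.1 k1⟩

theorem cubic_zero (k1 k2 k3 k4 : ℂ) (y z : Fin 4 → ℂ)
    (hd : ∀ i j, i ≠ j → y j * z i - y i * z j ≠ 0)
    (h : ∀ i, k1 * y i ^ 3 + k2 * (y i ^ 2 * z i) + k3 * (y i * z i ^ 2) + k4 * z i ^ 3 = 0) :
    k1 = 0 ∧ k2 = 0 ∧ k3 = 0 ∧ k4 = 0 := by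
  have hdet : (Matrix.projVandermonde y z).det ≠ 0 := by
    rw [Matrix.det_projVandermonde]
    refine Finset.prod_ne_zero_iff.2 fun i _ => Finset.prod_ne_zero_iff.2 fun j hj => ?_
    exact hd i j (Finset.mem_Ioi.1 hj).ne
  have hm : Matrix.projVandermonde y z *ᵥ ![k4, k3, k2, k1] = 0 := by
    ext i
    simp [Matrix.mulVec, dotProduct, Fin.sum_univ_four, Matrix.projVandermonde_apply, Fin.rev]
    linear_combination h i
  have h0 := Matrix.eq_zero_of_mulVec_eq_zero hdet hm
  exact ⟨congrFun h0 3, congrFun h0 2, congrFun h0 1, congrFun h0 0⟩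

theorem indep_of_nonprop (β γ β' γ' : ℂ)
    (h : ¬ ∃ c : ℂ, (C β * X 1 + C γ * X 2 : MvPolynomial (Fin 3) ℂ)
      = c • (C β' * X 1 + C γ' * X 2))
    (h0 : (C β' * X 1 + C γ' * X 2 : MvPolynomial (Fin 3) ℂ) ≠ 0) :
    β * γ' - γ * β' ≠ 0 := by
  intro hd
  by_cases hb : β' = 0
  · by_cases hc : γ' = 0
    · apply h0; simp [hb, hc]
    · have hβ : β = 0 := by
        have : β * γ' = 0 := by rw [hb] at hd; linear_combination hd
        exact (mul_eq_zero.1 this).resolve_right hc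
      refine h ⟨γ / γ', ?_⟩
      rw [MvPolynomial.smul_eq_C_mul, hβ, hb]
      have : γ = γ / γ' * γ' := by field_simp
      conv_lhs => rw [this]
      simp only [map_mul, map_zero]; ring
  · refine h ⟨β / β', ?_⟩
    rw [MvPolynomial.smul_eq_C_mul]
    have h1 : β = β / β' * β' := by field_simp
    have h2 : γ = β / β' * γ' := by field_simp; linear_combination -hd
    conv_lhs => rw [h1, h2]
    simp only [map_mul]; ring

theorem backward_normal (g : MvPolynomial (Fin 3) ℂ) (hg : g.IsHomogeneous 4) (hs : CSmooth g)
    (l : Fin 4 → MvPolynomial (Fin 3) ℂ) (hl : ∀ i, CBit g (l i))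
    (hne : ∀ i j, i ≠ j → ¬ ∃ c : ℂ, l i = c • l j)
    (h0 : ∀ i, eval ![1, 0, 0] (l i) = 0) : CAut g := by
  obtain ⟨a, b1, b2, c1, c2, c3, d1, d2, d3, d4, e1, e2, e3, e4, e5, rfl⟩ := exists_quart g hg
  have hl' : ∀ i, ∃ β γ : ℂ, l i = C β * X 1 + C γ * X 2 := by
    intro i
    obtain ⟨p, q, r, h⟩ := exists_lin (l i) (hl i).2.1
    have := h0 i
    rw [h] at this
    simp at this
    exact ⟨q, r, by rw [h, this]; simp⟩
  choose β γ hβγ using hl'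
  have hd : ∀ i j, i ≠ j → β i * γ j - γ i * β j ≠ 0 := by
    intro i j hij
    apply indep_of_nonprop
    · rw [← hβγ, ← hβγ]; exact hne i j hij
    · rw [← hβγ]; exact (hl j).1
  have hq := fun i => line_coeffs a b1 b2 c1 c2 c3 d1 d2 d3 d4 e1 e2 e3 e4 e5 (β i) (γ i)
    (by rw [← hβγ]; exact hl i)
  have ha : a ≠ 0 := by
    intro ha
    have hb : ∀ i, b1 * γ i + b2 * (-β i) = 0 := by
      intro i
      obtain ⟨q0, q1, q2, h1, h2, -⟩ := hq i
      have : q0 = 0 := by rw [ha] at h1; exact pow_eq_zero_iff (two_ne_zero) |>.1 h1.symm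
      rw [h2, this]; ring
    have hd01 := hd 0 1 (by decide)
    have hb1 : b1 = 0 := by
      refine (mul_eq_zero.1 (?_ : b1 * (β 0 * γ 1 - γ 0 * β 1) = 0)).resolve_right hd01
      linear_combination β 0 * hb 1 - β 1 * hb 0
    have hb2 : b2 = 0 := by
      refine (mul_eq_zero.1 (?_ : b2 * (β 0 * γ 1 - γ 0 * β 1) = 0)).resolve_right hd01
      linear_combination γ 0 * hb 1 - γ 1 * hb 0
    have := hs ![1, 0, 0] (by
      intro i
      fin_cases i <;> simp [quart, ha, hb1, hb2, pderiv_X, Pi.single_apply])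
    simpa using congrFun this 0
  obtain ⟨m1, hm1⟩ : ∃ m1, b1 = 2 * a * m1 := ⟨b1 / (2 * a), by field_simp⟩
  obtain ⟨m2, hm2⟩ : ∃ m2, b2 = 2 * a * m2 := ⟨b2 / (2 * a), by field_simp⟩
  obtain ⟨k1, k2, k3, k4⟩ := cubic_zero (d1 - m1 * c1 + a * m1 ^ 3)
    (d2 - (m1 * c2 + m2 * c1) + 3 * a * m1 ^ 2 * m2)
    (d3 - (m1 * c3 + m2 * c2) + 3 * a * m1 * m2 ^ 2)
    (d4 - m2 * c3 + a * m2 ^ 3) γ (fun i => -β i) (by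
      intro i j hij
      have := hd j i hij.symm
      intro h
      apply this
      linear_combination h) (by
      intro i
      obtain ⟨q0, q1, q2, h1, h2, h3, h4⟩ := hq i
      have hq0 : q0 ≠ 0 := by rintro rfl; apply ha; rw [h1]; ring
      have h5 : q0 * (m1 * γ i + m2 * (-β i)) = q1 := by
        apply mul_left_cancel₀ (mul_ne_zero two_ne_zero hq0)
        rw [hm1, hm2, h1] at h2
        linear_combination h2
      have h6 : (d1 * γ i ^ 3 + d2 * (γ i ^ 2 * (-β i)) + d3 * (γ i * (-β i) ^ 2)
          + d4 * (-β i) ^ 3) - (m1 * γ i + m2 * (-β i)) *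
          (c1 * γ i ^ 2 + c2 * (γ i * (-β i)) + c3 * (-β i) ^ 2)
          + a * (m1 * γ i + m2 * (-β i)) ^ 3 = 0 := by
        rw [h4, h3, h1, ← h5]; ring
      linear_combination h6)
  have hd1 : d1 = m1 * c1 - a * m1 ^ 3 := by linear_combination k1
  have hd2 : d2 = (m1 * c2 + m2 * c1) - 3 * a * m1 ^ 2 * m2 := by linear_combination k2
  have hd3 : d3 = (m1 * c3 + m2 * c2) - 3 * a * m1 * m2 ^ 2 := by linear_combination k3
  have hd4 : d4 = m2 * c3 - a * m2 ^ 3 := by linear_combination k4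
  refine ⟨!![-1, -m1, -m2; 0, 1, 0; 0, 0, 1], ?_, ?_, ⟨1, ?_⟩, ?_⟩
  · rw [Matrix.det_fin_three]; simp
  · rintro ⟨c, hc⟩
    have h1 := congrFun (congrFun hc 0) 0
    have h2 := congrFun (congrFun hc 1) 1
    simp at h1 h2
    rw [← h1] at h2
    norm_num at h2
  · ext i j; fin_cases i <;> fin_cases j <;> simp [Matrix.mul_apply, Fin.sum_univ_three]
  · apply MvPolynomial.funext
    intro x
    rw [eval_lsub]
    simp [quart, Matrix.mulVec, dotProduct, Fin.sum_univ_three]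
    rw [hd1, hd2, hd3, hd4, hm1, hm2]
    ring

theorem backward (g : MvPolynomial (Fin 3) ℂ) (hg : g.IsHomogeneous 4) (hs : CSmooth g)
    (h : CFour g) : CAut g := by
  obtain ⟨l, hl, hne, P, hP, h0⟩ := h
  obtain ⟨i, hi⟩ : ∃ i, P i ≠ 0 := by
    by_contra! hh
    exact hP (funext hh)
  obtain ⟨M, N, hNM, hM, -, -⟩ := exists_frame P (Pi.single i 1) (by simpa using hi)
  have hMN : M * N = 1 := mul_eq_one_comm.1 hNM
  have := backward_normal (lsub M g) (lsub_homog _ _ _ hg) (hs.lsub hNM) (fun i => lsub M (l i))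
    (fun i => (hl i).lsub hNM) (by
      rintro i j hij ⟨c, hc⟩
      have hc' : lsub M (l i) = c • lsub M (l j) := hc
      refine hne i j hij ⟨c, ?_⟩
      rw [← lsub_inv hMN (l i), hc', map_smul, lsub_inv hMN])
    (by intro i; rw [eval_lsub, hM, h0])
  have h2 := this.lsub hMN
  rwa [lsub_inv hMN] at h2

theorem bin4 (k0 k1 k2 k3 k4 : ℂ) : ∃ p q m0 m1 m2 m3 : ℂ,
    k0 = p * m0 ∧ k1 = p * m1 + q * m0 ∧ k2 = p * m2 + q * m1 ∧ k3 = p * m3 + q * m2 ∧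
      k4 = q * m3 := by
  by_cases h : k0 = 0
  · exact ⟨0, 1, k1, k2, k3, k4, by simp [h], by simp, by simp, by simp, by simp⟩
  · let P : Polynomial ℂ := Polynomial.C k0 * Polynomial.X ^ 4 + Polynomial.C k1 * Polynomial.X ^ 3
      + Polynomial.C k2 * Polynomial.X ^ 2 + Polynomial.C k3 * Polynomial.X + Polynomial.C k4
    have hdeg : P.degree = 4 := by unfold P; compute_degree!
    obtain ⟨r, hr⟩ := IsAlgClosed.exists_root P (by rw [hdeg]; norm_num)
    simp [P, Polynomial.IsRoot.def] at hr
    refine ⟨1, -r, k0, k1 + r * k0, k2 + r * (k1 + r * k0), k3 + r * (k2 + r * (k1 + r * k0)),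
      by ring, by ring, by ring, by ring, ?_⟩
    linear_combination hr

theorem bin3 (k0 k1 k2 k3 : ℂ) : ∃ p q m0 m1 m2 : ℂ,
    k0 = p * m0 ∧ k1 = p * m1 + q * m0 ∧ k2 = p * m2 + q * m1 ∧ k3 = q * m2 := by
  by_cases h : k0 = 0
  · exact ⟨0, 1, k1, k2, k3, by simp [h], by simp, by simp, by simp⟩
  · let P : Polynomial ℂ := Polynomial.C k0 * Polynomial.X ^ 3 + Polynomial.C k1 * Polynomial.X ^ 2
      + Polynomial.C k2 * Polynomial.X + Polynomial.C k3
    have hdeg : P.degree = 3 := by unfold P; compute_degree!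
    obtain ⟨r, hr⟩ := IsAlgClosed.exists_root P (by rw [hdeg]; norm_num)
    simp [P, Polynomial.IsRoot.def] at hr
    refine ⟨1, -r, k0, k1 + r * k0, k2 + r * (k1 + r * k0), by ring, by ring, by ring, ?_⟩
    linear_combination hr

theorem bin2 (k0 k1 k2 : ℂ) : ∃ p q m0 m1 : ℂ,
    k0 = p * m0 ∧ k1 = p * m1 + q * m0 ∧ k2 = q * m1 := by
  by_cases h : k0 = 0
  · exact ⟨0, 1, k1, k2, by simp [h], by simp, by simp⟩
  · let P : Polynomial ℂ := Polynomial.C k0 * Polynomial.X ^ 2 + Polynomial.C k1 * Polynomial.X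
      + Polynomial.C k2
    have hdeg : P.degree = 2 := by unfold P; compute_degree!
    obtain ⟨r, hr⟩ := IsAlgClosed.exists_root P (by rw [hdeg]; norm_num)
    simp [P, Polynomial.IsRoot.def] at hr
    refine ⟨1, -r, k0, k1 + r * k0, by ring, by ring, ?_⟩
    linear_combination hr

theorem bin_factor (k0 k1 k2 k3 k4 : ℂ) : ∃ p q : Fin 4 → ℂ,
    (C k0 * X 1 ^ 4 + C k1 * (X 1 ^ 3 * X 2) + C k2 * (X 1 ^ 2 * X 2 ^ 2)
      + C k3 * (X 1 * X 2 ^ 3) + C k4 * X 2 ^ 4 : MvPolynomial (Fin 3) ℂ)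
      = ∏ i, (C (p i) * X 1 + C (q i) * X 2) := by
  obtain ⟨p, q, m0, m1, m2, m3, rfl, rfl, rfl, rfl, rfl⟩ := bin4 k0 k1 k2 k3 k4
  obtain ⟨p', q', n0, n1, n2, rfl, rfl, rfl, rfl⟩ := bin3 m0 m1 m2 m3
  obtain ⟨p2, q2, r, s, rfl, rfl, rfl⟩ := bin2 n0 n1 n2
  refine ⟨![p, p', p2, r], ![q, q', q2, s], ?_⟩
  rw [Fin.prod_univ_four]
  simp
  ring

theorem lin_zero (p q : ℂ) : ∃ y z : ℂ, ¬ (y = 0 ∧ z = 0) ∧ p * y + q * z = 0 := by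
  by_cases h : p = 0 ∧ q = 0
  · exact ⟨1, 0, by simp, by simp [h.1]⟩
  · exact ⟨q, -p, fun hh => h ⟨by simpa using hh.2, hh.1⟩, by ring⟩

theorem sing_of_square (g Q l m : MvPolynomial (Fin 3) ℂ) (hs : CSmooth g)
    (hg : g = Q ^ 2 + l ^ 2 * m) (P : Fin 3 → ℂ) (hQ : eval P Q = 0) (hl : eval P l = 0) :
    P = 0 := by
  apply hs
  intro i
  rw [hg]
  simp [Derivation.leibniz, Derivation.leibniz_pow, hQ, hl]

theorem lin_homog (p q : ℂ) : (C p * X 1 + C q * X 2 : MvPolynomial (Fin 3) ℂ).IsHomogeneous 1 := by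
  have h := fun (c : ℂ) (j : Fin 3) => (isHomogeneous_C (Fin 3) c).mul (isHomogeneous_X ℂ j)
  simp only [zero_add] at h
  exact (h _ _).add (h _ _)

theorem forward_even (a c1 c2 c3 e1 e2 e3 e4 e5 : ℂ)
    (hs : CSmooth (quart a 0 0 c1 c2 c3 0 0 0 0 e1 e2 e3 e4 e5)) :
    CFour (quart a 0 0 c1 c2 c3 0 0 0 0 e1 e2 e3 e4 e5) := by
  have ha : a ≠ 0 := by
    intro ha
    have := hs ![1, 0, 0] (by
      intro i
      fin_cases i <;> simp [quart, ha, pderiv_X, Pi.single_apply])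
    simpa using congrFun this 0
  obtain ⟨s, hsa⟩ := IsAlgClosed.exists_pow_nat_eq a (n := 2) (by norm_num)
  have hs0 : s ≠ 0 := by rintro rfl; apply ha; rw [← hsa]; ring
  obtain ⟨r1, h1⟩ : ∃ r, c1 = 2 * s * r := ⟨c1 / (2 * s), by field_simp⟩
  obtain ⟨r2, h2⟩ : ∃ r, c2 = 2 * s * r := ⟨c2 / (2 * s), by field_simp⟩
  obtain ⟨r3, h3⟩ : ∃ r, c3 = 2 * s * r := ⟨c3 / (2 * s), by field_simp⟩
  obtain ⟨p, q, hpq⟩ := bin_factor (e1 - r1 ^ 2) (e2 - 2 * r1 * r2) (e3 - r2 ^ 2 - 2 * r1 * r3)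
    (e4 - 2 * r2 * r3) (e5 - r3 ^ 2)
  set g := quart a 0 0 c1 c2 c3 0 0 0 0 e1 e2 e3 e4 e5 with hgdef
  set l : Fin 4 → MvPolynomial (Fin 3) ℂ := fun i => C (p i) * X 1 + C (q i) * X 2 with hldef
  set Q : MvPolynomial (Fin 3) ℂ := C s * X 0 ^ 2 + (C r1 * X 1 ^ 2 + C r2 * (X 1 * X 2)
    + C r3 * X 2 ^ 2) with hQdef
  have hg : g = Q ^ 2 + ∏ i, l i := by
    rw [hldef, ← hpq, hgdef, hQdef, h1, h2, h3, ← hsa]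
    simp [quart]
    have h2C : (C 2 : MvPolynomial (Fin 3) ℂ) = 2 := rfl
    try rw [h2C]
    ring
  have hQh : Q.IsHomogeneous 2 := by
    have h := fun (c : ℂ) (j k : Fin 3) => (isHomogeneous_C (Fin 3) c).mul
      ((isHomogeneous_X ℂ j).mul (isHomogeneous_X ℂ k))
    simp only [zero_add, Nat.reduceAdd] at h
    rw [hQdef]
    simp only [pow_two]
    exact (h _ _ _).add (((h _ _ _).add (h _ _ _)).add (h _ _ _))
  have hne : ∀ i j, i ≠ j → ¬ ∃ c : ℂ, l i = c • l j := by
    rintro i j hij ⟨c, hc⟩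
    obtain ⟨y, z, hyz, hl0⟩ := lin_zero (p j) (q j)
    obtain ⟨x, hx⟩ := IsAlgClosed.exists_pow_nat_eq
      (-(r1 * y ^ 2 + r2 * (y * z) + r3 * z ^ 2) / s) (n := 2) (by norm_num)
    have hx' : s * x ^ 2 = -(r1 * y ^ 2 + r2 * (y * z) + r3 * z ^ 2) := by
      rw [hx]; field_simp
    have := sing_of_square g Q (l j) (C c * ∏ k ∈ (Finset.univ.erase i).erase j, l k) hs (by
      rw [hg, ← Finset.mul_prod_erase Finset.univ l (Finset.mem_univ i),
        ← Finset.mul_prod_erase (Finset.univ.erase i) l (a := j) (by simp [hij.symm]), hc,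
        MvPolynomial.smul_eq_C_mul]
      ring) ![x, y, z] (by
        rw [hQdef]; simp; linear_combination hx') (by
        rw [hldef]; simpa using hl0)
    exact hyz ⟨by simpa using congrFun this 1, by simpa using congrFun this 2⟩
  refine ⟨l, ?_, hne, ![1, 0, 0], ?_, ?_⟩
  · intro i
    refine ⟨?_, lin_homog _ _, Q, ∏ k ∈ Finset.univ.erase i, l k, hQh, ?_, ?_⟩
    · intro h
      obtain ⟨j, hj⟩ := exists_ne i
      exact hne i j hj.symm ⟨0, by rw [h, zero_smul]⟩
    · have := IsHomogeneous.prod (Finset.univ.erase i) l (fun _ => 1) (fun k _ => lin_homog _ _)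
      simpa using this
    · rw [hg, Finset.prod_erase_mul _ _ (Finset.mem_univ i)]
  · intro h
    simpa using congrFun h 0
  · intro i; simp [hldef]

theorem forward_normal (g : MvPolynomial (Fin 3) ℂ) (hg : g.IsHomogeneous 4) (hs : CSmooth g)
    (t : ℂ) (h : lsub (Matrix.diagonal ![-t, t, t]) g = g) : CFour g := by
  have hg0 : g ≠ 0 := by
    rintro rfl
    have := hs ![1, 0, 0] (by simp)
    simpa using congrFun this 0
  have ht : (t ^ 2) ^ 4 = 1 := by
    have h2 : lsub ((t ^ 2) • 1) g = g := by
      have : (t ^ 2) • (1 : Matrix (Fin 3) (Fin 3) ℂ)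
          = Matrix.diagonal ![-t, t, t] * Matrix.diagonal ![-t, t, t] := by
        ext i j; fin_cases i <;> fin_cases j <;> simp [pow_two]
      rw [this, ← lsub_lsub, h, h]
    rw [lsub_scalar _ _ hg] at h2
    have h3 : (C ((t ^ 2) ^ 4) - 1) * g = 0 := by rw [sub_mul, h2]; ring
    have h4 := (mul_eq_zero.1 h3).resolve_right hg0
    have := congrArg (eval 0) h4
    simp at this
    linear_combination this
  have ht' : t ^ 4 = 1 ∨ t ^ 4 = -1 := by
    have : (t ^ 4 - 1) * (t ^ 4 + 1) = 0 := by linear_combination ht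
    rcases mul_eq_zero.1 this with h | h
    · left; linear_combination h
    · right; linear_combination h
  obtain ⟨a, b1, b2, c1, c2, c3, d1, d2, d3, d4, e1, e2, e3, e4, e5, rfl⟩ := exists_quart g hg
  have key : ∀ x y z : ℂ, t ^ 4 * (a * x ^ 4 - (b1 * y + b2 * z) * x ^ 3
      + (c1 * y ^ 2 + c2 * (y * z) + c3 * z ^ 2) * x ^ 2
      - (d1 * y ^ 3 + d2 * (y ^ 2 * z) + d3 * (y * z ^ 2) + d4 * z ^ 3) * x
      + (e1 * y ^ 4 + e2 * (y ^ 3 * z) + e3 * (y ^ 2 * z ^ 2) + e4 * (y * z ^ 3) + e5 * z ^ 4))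
      = a * x ^ 4 + (b1 * y + b2 * z) * x ^ 3
      + (c1 * y ^ 2 + c2 * (y * z) + c3 * z ^ 2) * x ^ 2
      + (d1 * y ^ 3 + d2 * (y ^ 2 * z) + d3 * (y * z ^ 2) + d4 * z ^ 3) * x
      + (e1 * y ^ 4 + e2 * (y ^ 3 * z) + e3 * (y ^ 2 * z ^ 2) + e4 * (y * z ^ 3) + e5 * z ^ 4) := by
    intro x y z
    have := congrArg (eval ![x, y, z]) h
    rw [eval_lsub] at this
    simp [quart, Matrix.mulVec_diagonal] at this
    linear_combination this
  rcases ht' with ht' | ht'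
  · have he : quart a b1 b2 c1 c2 c3 d1 d2 d3 d4 e1 e2 e3 e4 e5
        = quart a 0 0 c1 c2 c3 0 0 0 0 e1 e2 e3 e4 e5 := by
      apply MvPolynomial.funext
      intro v
      have := key (v 0) (v 1) (v 2)
      rw [ht'] at this
      simp [quart]
      linear_combination (-1/2) * this
    rw [he] at hs ⊢
    exact forward_even _ _ _ _ _ _ _ _ _ hs
  · exfalso
    have he : quart a b1 b2 c1 c2 c3 d1 d2 d3 d4 e1 e2 e3 e4 e5
        = quart 0 b1 b2 0 0 0 d1 d2 d3 d4 0 0 0 0 0 := by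
      apply MvPolynomial.funext
      intro v
      have := key (v 0) (v 1) (v 2)
      rw [ht'] at this
      simp [quart]
      linear_combination (-1/2) * this
    rw [he] at hs
    obtain ⟨p, q, m0, m1, m2, rfl, rfl, rfl, rfl⟩ := bin3 d1 d2 d3 d4
    obtain ⟨y, z, hyz, h0⟩ := lin_zero p q
    have := hs ![0, y, z] (by
      intro i
      fin_cases i
      · simp [quart, pderiv_X, Pi.single_apply]
        linear_combination (m0 * y ^ 2 + m1 * y * z + m2 * z ^ 2) * h0
      · simp [quart, pderiv_X, Pi.single_apply]
      · simp [quart, pderiv_X, Pi.single_apply])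
    exact hyz ⟨by simpa using congrFun this 1, by simpa using congrFun this 2⟩

theorem rank_one_form (D : Matrix (Fin 3) (Fin 3) ℂ) (h : D.rank ≤ 1) :
    ∃ u v : Fin 3 → ℂ, ∀ i j, D i j = u i * v j := by
  unfold Matrix.rank at h
  rw [Submodule.finrank_le_one_iff_isPrincipal] at h
  obtain ⟨u, hu⟩ := h
  have : ∀ j, ∃ c : ℂ, c • u = D *ᵥ Pi.single j 1 := by
    intro j
    rw [← Submodule.mem_span_singleton, ← hu]
    exact ⟨Pi.single j 1, rfl⟩
  choose v hv using this
  refine ⟨u, v, fun i j => ?_⟩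
  have := congrFun (hv j) i
  simp at this
  rw [← this, mul_comm]

theorem involution_form (A : Matrix (Fin 3) (Fin 3) ℂ) (hA : IsUnit A.det)
    (hs : ¬ ∃ c : ℂ, A = c • (1 : Matrix (Fin 3) (Fin 3) ℂ))
    (c : ℂ) (hc : A * A = c • (1 : Matrix (Fin 3) (Fin 3) ℂ)) :
    ∃ (t : ℂ) (u v : Fin 3 → ℂ), t ≠ 0 ∧ A = t • 1 + Matrix.vecMulVec u v ∧
      v ⬝ᵥ u = -2 * t := by
  obtain ⟨s, hsc⟩ := IsAlgClosed.exists_pow_nat_eq c (n := 2) (by norm_num)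
  have hA0 : A.det ≠ 0 := hA.ne_zero
  have hc0 : c ≠ 0 := by
    rintro rfl
    have := congrArg Matrix.det hc
    rw [Matrix.det_mul, zero_smul, Matrix.det_zero] at this
    exact hA0 (by simpa using this)
  have H : ∃ t : ℂ, t ^ 2 = c ∧ (A - t • 1).rank ≤ 1 := by
    have h0 : (A - s • 1) * (A - (-s) • 1) = 0 := by
      simp only [sub_mul, mul_sub, hc, ← hsc]
      simp [pow_two, smul_smul]
      abel
    have := Matrix.rank_add_rank_le_card_of_mul_eq_zero h0
    simp only [Fintype.card_fin] at this
    by_cases h : (A - s • 1).rank ≤ 1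
    · exact ⟨s, hsc, h⟩
    · exact ⟨-s, by rw [neg_sq, hsc], by omega⟩
  obtain ⟨t, htc, hr⟩ := H
  obtain ⟨u, v, huv⟩ := rank_one_form _ hr
  have hform : A = t • 1 + Matrix.vecMulVec u v := by
    have : A - t • 1 = Matrix.vecMulVec u v := by ext i j; rw [huv, Matrix.vecMulVec_apply]
    rw [← this]; abel
  have ht : t ≠ 0 := by rintro rfl; apply hc0; rw [← htc]; ring
  refine ⟨t, u, v, ht, hform, ?_⟩
  have h1 : (2 * t + v ⬝ᵥ u) • Matrix.vecMulVec u v = 0 := by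
    have h2 : Matrix.vecMulVec u v * Matrix.vecMulVec u v = (v ⬝ᵥ u) • Matrix.vecMulVec u v := by
      ext i j
      simp [Matrix.mul_apply, Matrix.vecMulVec_apply, dotProduct, Fin.sum_univ_three]
      ring
    have h3 := hc
    rw [hform, ← htc, add_mul, mul_add, mul_add, h2] at h3
    simp only [smul_mul_assoc, one_mul, mul_smul_comm, mul_one, smul_smul] at h3
    rw [← pow_two, add_assoc, add_eq_left] at h3
    rw [← h3, add_smul, two_mul, add_smul]; abel
  rcases smul_eq_zero.1 h1 with h | h
  · linear_combination h
  · exact absurd ⟨t, by rw [hform, h, add_zero]⟩ hs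

theorem forward (g : MvPolynomial (Fin 3) ℂ) (hg : g.IsHomogeneous 4) (hs : CSmooth g)
    (h : CAut g) : CFour g := by
  obtain ⟨A, hA, hns, ⟨c, hc⟩, hf⟩ := h
  obtain ⟨t, u, v, ht, hform, hvu⟩ := involution_form A hA hns c hc
  obtain ⟨M, N, hNM, hM0, hM1, hM2⟩ := exists_frame u v (by
    rw [hvu]; exact mul_ne_zero (by norm_num) ht)
  have hMN : M * N = 1 := mul_eq_one_comm.1 hNM
  have hAM : A * M = M * Matrix.diagonal ![-t, t, t] := by
    have h0 : ∀ i, M i 0 = u i := by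
      intro i
      rw [← hM0]; simp [Matrix.mulVec, dotProduct, Fin.sum_univ_three]
    simp [Matrix.mulVec, dotProduct, Fin.sum_univ_three] at hM1 hM2 hvu
    rw [hform, add_mul, smul_mul_assoc, one_mul]
    ext i j
    fin_cases j
    · simp [Matrix.mul_apply, Matrix.vecMulVec_apply, Fin.sum_univ_three, add_mul, h0]
      linear_combination u i * hvu
    · simp [Matrix.mul_apply, Matrix.vecMulVec_apply, Fin.sum_univ_three, add_mul]
      linear_combination u i * hM1
    · simp [Matrix.mul_apply, Matrix.vecMulVec_apply, Fin.sum_univ_three, add_mul]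
      linear_combination u i * hM2
  have := forward_normal (lsub M g) (lsub_homog _ _ _ hg) (hs.lsub hNM) t (by
    rw [lsub_lsub, ← hAM, ← lsub_lsub, hf])
  have h2 := this.lsub hMN
  rwa [lsub_inv hMN] at h2

/-- A smooth psd ternary quartic has an automorphism of order 2 if and only if
four different bitangents of `f` intersect in a common point. -/
theorem order_two_automorphism_iff_four_concurrent_bitangents
    (f : MvPolynomial (Fin 3) ℝ) (hhom : f.IsHomogeneous 4)
    (hsm : IsSmooth f) (hpsd : IsPsd f) :
    HasOrder2Aut f ↔
      ∃ l : Fin 4 → MvPolynomial (Fin 3) ℂ,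
        (∀ i, IsBitangent f (l i)) ∧
        (∀ i j, i ≠ j → ¬ ∃ c : ℂ, l i = c • l j) ∧
        ∃ P : Fin 3 → ℂ, P ≠ 0 ∧ ∀ i, eval P (l i) = 0 := by
  have hg : (map (algebraMap ℝ ℂ) f).IsHomogeneous 4 := hhom.map _
  have hs : CSmooth (map (algebraMap ℝ ℂ) f) := hsm
  exact ⟨fun h => forward _ hg hs h, fun h => backward _ hg hs h⟩
end

section
/- Let f ∈ ℝ[x,y,z] be a smooth psd ternary quartic. Then f has an automorphism of order 2 if and only if there exist T ∈ GL₃(ℂ), a homogeneous polynomial f₂ of degree 2 in the variables x, y only, and scalars a, b, c, d ∈ ℂ such that the complexification of f satisfies f(T·(x,y,z)ᵀ) = (z² − f₂(x,y))² − 4xy(ax+by)(cx+dy) as polynomials in ℂ[x,y,z]. -/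
open MvPolynomial Matrix

lemma eval_subst (A : Matrix (Fin 3) (Fin 3) ℂ) (g : MvPolynomial (Fin 3) ℂ) (v : Fin 3 → ℂ) :
    eval v (aeval (fun i => ∑ j, MvPolynomial.C (A i j) * X j) g) = eval (A *ᵥ v) g := by
  induction g using MvPolynomial.induction_on with
  | C a => simp
  | add p q hp hq => simp only [map_add, hp, hq]
  | mul_X p i hp => rw [map_mul, map_mul, hp, map_mul]; simp [Matrix.mulVec, dotProduct]

lemma hasDerivAt_line (g : MvPolynomial (Fin 3) ℂ) (a : Fin 3 → ℂ) (i : Fin 3) :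
    HasDerivAt (fun t : ℂ => eval (a + t • Pi.single i 1) g) (eval a (pderiv i g)) 0 := by
  induction g using MvPolynomial.induction_on with
  | C c => simpa using hasDerivAt_const (0 : ℂ) c
  | add p q hp hq => simpa using hp.fun_add hq
  | mul_X p j hp =>
    have h : HasDerivAt (fun t : ℂ => a j + t * (Pi.single i (1 : ℂ) : Fin 3 → ℂ) j)
        ((Pi.single i (1 : ℂ) : Fin 3 → ℂ) j) 0 := by
      simpa using ((hasDerivAt_id (0 : ℂ)).mul_const
        ((Pi.single i (1 : ℂ) : Fin 3 → ℂ) j)).const_add (a j)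
    have := hp.fun_mul h
    simp only [map_mul, eval_X, Pi.add_apply, Pi.smul_apply, smul_eq_mul]
    refine HasDerivAt.congr_deriv this ?_
    rw [Derivation.leibniz, pderiv_X]
    by_cases hij : i = j
    · subst hij
      simp
      ring
    · have hji : ¬ j = i := fun h => hij h.symm
      simp [Pi.single_apply, hij, hji]
      try ring

/-- Singular point of a function, through directional derivatives. -/
def SingAt (F : (Fin 3 → ℂ) → ℂ) (a : Fin 3 → ℂ) : Prop :=
  ∀ v : Fin 3 → ℂ, HasDerivAt (fun t : ℂ => F (a + t • v)) 0 0

lemma SingAt.pderiv {g : MvPolynomial (Fin 3) ℂ} {a : Fin 3 → ℂ}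
    (h : SingAt (fun v => eval v g) a) (i : Fin 3) : eval a (pderiv i g) = 0 :=
  (hasDerivAt_line g a i).unique (h _)

lemma SingAt.comp {F : (Fin 3 → ℂ) → ℂ} {a : Fin 3 → ℂ} (P : Matrix (Fin 3) (Fin 3) ℂ)
    (hP : IsUnit P.det) (h : SingAt (fun v => F (P *ᵥ v)) a) : SingAt F (P *ᵥ a) := by
  intro v
  have := h (P⁻¹ *ᵥ v)
  simpa [Matrix.mulVec_add, Matrix.mulVec_smul, Matrix.mulVec_mulVec,
    Matrix.mul_nonsing_inv P hP] using this

lemma hasDerivAt_prod_zero {P Q : ℂ → ℂ} (hP : Differentiable ℂ P) (hQ : Differentiable ℂ Q)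
    (h1 : P 0 = 0) (h2 : Q 0 = 0) : HasDerivAt (fun t => P t * Q t) 0 0 := by
  have := (hP 0).hasDerivAt.fun_mul (hQ 0).hasDerivAt
  simpa [h1, h2] using this

lemma quartic_form (g : MvPolynomial (Fin 3) ℂ) (hg : g.IsHomogeneous 4) :
    ∃ c : ℕ → ℕ → ℂ, ∀ v : Fin 3 → ℂ, eval v g =
      ∑ i ∈ Finset.range 5, ∑ j ∈ Finset.range (5 - i),
        c i j * v 0 ^ i * v 1 ^ j * v 2 ^ (4 - i - j) := by
  classical
  have key : ∀ S : Finset (Fin 3 →₀ ℕ), (∀ d ∈ S, d 0 + d 1 + d 2 = 4) →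
      ∃ c : ℕ → ℕ → ℂ, ∀ v : Fin 3 → ℂ, ∑ d ∈ S, coeff d g * ∏ i, v i ^ d i =
      ∑ i ∈ Finset.range 5, ∑ j ∈ Finset.range (5 - i),
        c i j * v 0 ^ i * v 1 ^ j * v 2 ^ (4 - i - j) := by
    intro S
    induction S using Finset.induction_on with
    | empty => exact fun _ => ⟨fun _ _ => 0, by simp⟩
    | insert d S hd ih =>
      intro hS
      obtain ⟨c, hc⟩ := ih (fun d' hd' => hS d' (Finset.mem_insert_of_mem hd'))
      have h4 := hS d (Finset.mem_insert_self _ _)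
      refine ⟨fun i j => c i j + if i = d 0 then (if j = d 1 then coeff d g else 0) else 0,
        fun v => ?_⟩
      rw [Finset.sum_insert hd, hc]
      simp only [add_mul, Finset.sum_add_distrib, ite_mul, zero_mul]
      rw [add_comm]
      congr 1
      rw [Finset.sum_eq_single (d 0), Finset.sum_eq_single (d 1)]
      · rw [if_pos rfl, if_pos rfl, Fin.prod_univ_three,
          show 4 - d 0 - d 1 = d 2 by omega]
        ring
      · intro j _ hj
        rw [if_pos rfl, if_neg hj]
      · intro hj
        exact absurd (Finset.mem_range.mpr (by omega)) hj
      · intro i _ hi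
        simp [hi]
      · intro hj
        exact absurd (Finset.mem_range.mpr (by omega)) hj
  obtain ⟨c, hc⟩ := key g.support (by
    intro d hd
    have := hg (mem_support_iff.mp hd)
    simpa [Finsupp.weight_apply, Finsupp.sum_fintype, Fin.sum_univ_three] using this)
  exact ⟨c, fun v => by rw [MvPolynomial.eval_eq', hc]⟩

lemma homog_eval (g : MvPolynomial (Fin 3) ℂ) (hg : g.IsHomogeneous 4) (s : ℂ) (v : Fin 3 → ℂ) :
    eval (s • v) g = s ^ 4 * eval v g := by
  obtain ⟨c, hc⟩ := quartic_form g hg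
  rw [hc, hc]
  simp [Finset.sum_range_succ]
  ring

lemma invol_diag (B : Matrix (Fin 3) (Fin 3) ℂ) (hB : B * B = 1) (h1 : B ≠ 1)
    (h2 : 2 ≤ Module.finrank ℂ (LinearMap.ker (Matrix.mulVecLin (B - 1)))) :
    ∃ P : Matrix (Fin 3) (Fin 3) ℂ, IsUnit P.det ∧ B * P = P * !![1,0,0;0,1,0;0,0,-1] := by
  obtain ⟨w, hw⟩ : ∃ w, B *ᵥ w ≠ w := by
    by_contra! h
    apply h1
    apply Matrix.toLin'.injective
    apply LinearMap.ext
    intro v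
    simp [h]
  obtain ⟨p, hp⟩ := exists_linearIndependent_of_le_finrank h2
  set u : Fin 3 → ℂ := (p 0 : Fin 3 → ℂ) with hu
  set v : Fin 3 → ℂ := (p 1 : Fin 3 → ℂ) with hv
  set r : Fin 3 → ℂ := B *ᵥ w - w with hr
  have hr0 : r ≠ 0 := sub_ne_zero.mpr hw
  have hBu : B *ᵥ u = u := by
    have := (p 0).2
    rw [LinearMap.mem_ker] at this
    simpa [Matrix.sub_mulVec, sub_eq_zero] using this
  have hBv : B *ᵥ v = v := by
    have := (p 1).2
    rw [LinearMap.mem_ker] at this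
    simpa [Matrix.sub_mulVec, sub_eq_zero] using this
  have hBr : B *ᵥ r = - r := by
    rw [hr, Matrix.mulVec_sub, Matrix.mulVec_mulVec, hB]; simp
  have hind : ∀ a b : ℂ, a • u + b • v = 0 → a = 0 ∧ b = 0 := by
    intro a b hab
    have h := Fintype.linearIndependent_iff.mp hp ![a, b] (by
      apply Subtype.ext
      simpa [Fin.sum_univ_two] using hab)
    exact ⟨h 0, h 1⟩
  have hmul : ∀ x : Fin 3 → ℂ, (Matrix.of ![u, v, r])ᵀ *ᵥ x = x 0 • u + x 1 • v + x 2 • r := by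
    intro x
    ext i
    simp [Matrix.mulVec, dotProduct, Fin.sum_univ_three]
    ring
  refine ⟨(Matrix.of ![u, v, r])ᵀ, ?_, ?_⟩
  · rw [isUnit_iff_ne_zero]
    intro h0
    obtain ⟨x, hx, hx0⟩ := Matrix.exists_mulVec_eq_zero_iff.mpr h0
    rw [hmul] at hx0
    have h3 : x 0 • u + x 1 • v - x 2 • r = 0 := by
      have := congrArg (fun y => B *ᵥ y) hx0
      simpa [Matrix.mulVec_add, Matrix.mulVec_smul, hBu, hBv, hBr, sub_eq_add_neg] using this
    have h4 : x 0 • u + x 1 • v = 0 := by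
      have : (2 : ℂ) • (x 0 • u + x 1 • v) = 0 := by
        calc _ = (x 0 • u + x 1 • v + x 2 • r) + (x 0 • u + x 1 • v - x 2 • r) := by module
          _ = 0 := by rw [hx0, h3, add_zero]
      exact (smul_eq_zero.mp this).resolve_left two_ne_zero
    have h5 : x 2 • r = 0 := by simpa [h4] using hx0
    obtain ⟨ha, hb⟩ := hind _ _ h4
    have hc : x 2 = 0 := by simpa [hr0] using h5
    apply hx
    ext i
    fin_cases i <;> simp [ha, hb, hc]
  · apply Matrix.toLin'.injective
    apply LinearMap.ext
    intro x
    simp only [Matrix.toLin'_apply]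
    rw [← Matrix.mulVec_mulVec, ← Matrix.mulVec_mulVec, hmul, hmul]
    simp only [Matrix.mulVec_add, Matrix.mulVec_smul, hBu, hBv, hBr]
    simp [Matrix.mulVec, dotProduct, Fin.sum_univ_three]

lemma invol_diag' (B : Matrix (Fin 3) (Fin 3) ℂ) (hB : B * B = 1) (h1 : B ≠ 1) (h1' : B ≠ -1) :
    ∃ (e : ℂ) (P : Matrix (Fin 3) (Fin 3) ℂ), e ^ 4 = 1 ∧ IsUnit P.det ∧
      e • B * P = P * !![1,0,0;0,1,0;0,0,-1] := by
  by_cases h2 : 2 ≤ Module.finrank ℂ (LinearMap.ker (Matrix.mulVecLin (B - 1)))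
  · obtain ⟨P, hP, h⟩ := invol_diag B hB h1 h2
    exact ⟨1, P, by simp, hP, by simpa using h⟩
  · obtain ⟨P, hP, h⟩ := invol_diag (-B) (by simpa using hB) (by
      intro h; apply h1'; rw [← h]; simp) (by
      have hsup : LinearMap.ker (Matrix.mulVecLin (B - 1)) ⊔
          LinearMap.ker (Matrix.mulVecLin (-B - 1)) = ⊤ := by
        rw [eq_top_iff]
        intro x _
        rw [Submodule.mem_sup]
        refine ⟨(2⁻¹ : ℂ) • (x + B *ᵥ x), ?_, (2⁻¹ : ℂ) • (x - B *ᵥ x), ?_, ?_⟩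
        · simp [Matrix.sub_mulVec, Matrix.mulVec_add, Matrix.mulVec_smul, hB]
          module
        · simp [Matrix.sub_mulVec, Matrix.neg_mulVec, Matrix.mulVec_sub, Matrix.mulVec_smul, hB]
        · module
      have := Submodule.finrank_add_le_finrank_add_finrank
        (LinearMap.ker (Matrix.mulVecLin (B - 1))) (LinearMap.ker (Matrix.mulVecLin (-B - 1)))
      rw [hsup] at this
      simp at this
      omega)
    exact ⟨-1, P, by norm_num, hP, by simpa using h⟩

lemma quad_factor (e0 e1 e2 : ℂ) : ∃ a b c d : ℂ, ∀ x y : ℂ,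
    e0 * x ^ 2 + e1 * x * y + e2 * y ^ 2 = (a * x + b * y) * (c * x + d * y) := by
  by_cases h : e0 = 0
  · exact ⟨0, 1, e1, e2, fun x y => by subst h; ring⟩
  · obtain ⟨t, ht⟩ := IsAlgClosed.exists_root
      (Polynomial.C e0 * Polynomial.X ^ 2 + Polynomial.C e1 * Polynomial.X + Polynomial.C e2) (by
        rw [Polynomial.degree_quadratic h]; norm_num)
    simp [Polynomial.IsRoot] at ht
    refine ⟨1, -t, e0, e1 + e0 * t, fun x y => ?_⟩
    linear_combination y ^ 2 * ht

lemma cubic_factor (e0 e1 e2 e3 : ℂ) : ∃ a b c0 c1 c2 : ℂ, (a ≠ 0 ∨ b ≠ 0) ∧ ∀ x y : ℂ,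
    e0 * x ^ 3 + e1 * x ^ 2 * y + e2 * x * y ^ 2 + e3 * y ^ 3
      = (a * x + b * y) * (c0 * x ^ 2 + c1 * x * y + c2 * y ^ 2) := by
  by_cases h : e0 = 0
  · exact ⟨0, 1, e1, e2, e3, by simp, fun x y => by subst h; ring⟩
  · obtain ⟨t, ht⟩ := IsAlgClosed.exists_root
      (Polynomial.C e0 * Polynomial.X ^ 3 + Polynomial.C e1 * Polynomial.X ^ 2 +
        Polynomial.C e2 * Polynomial.X + Polynomial.C e3) (by
        rw [Polynomial.degree_cubic h]; norm_num)
    simp [Polynomial.IsRoot] at ht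
    refine ⟨1, -t, e0, e1 + e0 * t, e2 + e1 * t + e0 * t ^ 2, by simp, fun x y => ?_⟩
    linear_combination y ^ 3 * ht

lemma quartic_factor (e0 e1 e2 e3 e4 : ℂ) : ∃ a b c0 c1 c2 c3 : ℂ, ∀ x y : ℂ,
    e0 * x ^ 4 + e1 * x ^ 3 * y + e2 * x ^ 2 * y ^ 2 + e3 * x * y ^ 3 + e4 * y ^ 4
      = (a * x + b * y) * (c0 * x ^ 3 + c1 * x ^ 2 * y + c2 * x * y ^ 2 + c3 * y ^ 3) := by
  by_cases h : e0 = 0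
  · exact ⟨0, 1, e1, e2, e3, e4, fun x y => by subst h; ring⟩
  · obtain ⟨t, ht⟩ := IsAlgClosed.exists_root
      (Polynomial.C e0 * Polynomial.X ^ 4 + (Polynomial.C e1 * Polynomial.X ^ 3 +
        Polynomial.C e2 * Polynomial.X ^ 2 + Polynomial.C e3 * Polynomial.X + Polynomial.C e4)) (by
        rw [Polynomial.degree_add_eq_left_of_degree_lt, Polynomial.degree_C_mul_X_pow _ h]
        · norm_num
        · rw [Polynomial.degree_C_mul_X_pow _ h]
          exact lt_of_le_of_lt Polynomial.degree_cubic_le (by norm_num))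
    simp [Polynomial.IsRoot] at ht
    refine ⟨1, -t, e0, e1 + e0 * t, e2 + e1 * t + e0 * t ^ 2,
      e3 + e2 * t + e1 * t ^ 2 + e0 * t ^ 3, fun x y => ?_⟩
    linear_combination y ^ 4 * ht

lemma full_factor (e0 e1 e2 e3 e4 : ℂ) : ∃ a1 b1 a2 b2 a3 b3 a4 b4 : ℂ, ∀ x y : ℂ,
    e0 * x ^ 4 + e1 * x ^ 3 * y + e2 * x ^ 2 * y ^ 2 + e3 * x * y ^ 3 + e4 * y ^ 4
      = (a1 * x + b1 * y) * (a2 * x + b2 * y) * (a3 * x + b3 * y) * (a4 * x + b4 * y) := by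
  obtain ⟨a1, b1, c0, c1, c2, c3, h1⟩ := quartic_factor e0 e1 e2 e3 e4
  obtain ⟨a2, b2, d0, d1, d2, -, h2⟩ := cubic_factor c0 c1 c2 c3
  obtain ⟨a3, b3, a4, b4, h3⟩ := quad_factor d0 d1 d2
  exact ⟨a1, b1, a2, b2, a3, b3, a4, b4, fun x y => by rw [h1, h2, h3]; ring⟩

/-- Odd case: the form is divisible by `z`, hence singular. -/
lemma odd_sing (G : (Fin 3 → ℂ) → ℂ) (e0 e1 e2 e3 k l : ℂ)
    (hG : ∀ v, G v = v 2 * (e0 * v 0 ^ 3 + e1 * v 0 ^ 2 * v 1 + e2 * v 0 * v 1 ^ 2 + e3 * v 1 ^ 3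
      + v 2 ^ 2 * (k * v 0 + l * v 1))) : ∃ a, a ≠ 0 ∧ SingAt G a := by
  obtain ⟨a, b, c0, c1, c2, hab, h⟩ := cubic_factor e0 e1 e2 e3
  refine ⟨![b, -a, 0], ?_, ?_⟩
  · intro h0
    have h1 := congrFun h0 0
    have h2 := congrFun h0 1
    simp at h1 h2
    tauto
  · intro v
    simp only [hG]
    apply hasDerivAt_prod_zero
    · simp only [Pi.add_apply, Pi.smul_apply]; fun_prop
    · simp only [Pi.add_apply, Pi.smul_apply]; fun_prop
    · simp
    · have := h b (-a)
      simp at this ⊢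
      rw [this]; ring_nf

lemma even_case (G : (Fin 3 → ℂ) → ℂ) (hsm : ∀ a, SingAt G a → a = 0)
    (α q0 q1 q2 e0 e1 e2 e3 e4 : ℂ)
    (hG : ∀ v, G v = α * v 2 ^ 4 + v 2 ^ 2 * (q0 * v 0 ^ 2 + q1 * v 0 * v 1 + q2 * v 1 ^ 2)
      + (e0 * v 0 ^ 4 + e1 * v 0 ^ 3 * v 1 + e2 * v 0 ^ 2 * v 1 ^ 2 + e3 * v 0 * v 1 ^ 3
        + e4 * v 1 ^ 4)) :
    ∃ (U : Matrix (Fin 3) (Fin 3) ℂ) (r0 r1 r2 a b c d : ℂ), IsUnit U.det ∧ ∀ v : Fin 3 → ℂ,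
      G (U *ᵥ v) = (v 2 ^ 2 - (r0 * v 0 ^ 2 + r1 * (v 0 * v 1) + r2 * v 1 ^ 2)) ^ 2
        - 4 * v 0 * v 1 * (a * v 0 + b * v 1) * (c * v 0 + d * v 1) := by
  have hα : α ≠ 0 := by
    intro hα
    have : SingAt G ![0, 0, 1] := by
      intro v
      have hfun : (fun t : ℂ => G (![0, 0, 1] + t • v)) = fun t : ℂ => t * (t *
          ((1 + t * v 2) ^ 2 * (q0 * v 0 ^ 2 + q1 * v 0 * v 1 + q2 * v 1 ^ 2)
      + t ^ 2 * (e0 * v 0 ^ 4 + e1 * v 0 ^ 3 * v 1 + e2 * v 0 ^ 2 * v 1 ^ 2 + e3 * v 0 * v 1 ^ 3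
        + e4 * v 1 ^ 4))) := by
        funext t
        rw [hG]
        simp [hα]
        ring
      rw [hfun]
      apply hasDerivAt_prod_zero
      · fun_prop
      · fun_prop
      · simp
      · simp
    have := congrFun (hsm _ this) 2
    simp at this
  obtain ⟨β, hβ⟩ := IsAlgClosed.exists_pow_nat_eq (α⁻¹) (n := 4) (by norm_num)
  have hβα : α * β ^ 4 = 1 := by rw [hβ]; exact mul_inv_cancel₀ hα
  have hβ0 : β ≠ 0 := by rintro rfl; simp at hβα
  obtain ⟨a1, b1, a2, b2, a3, b3, a4, b4, hf⟩ := full_factor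
    (e0 - β ^ 4 * q0 ^ 2 / 4) (e1 - β ^ 4 * (2 * q0 * q1) / 4)
    (e2 - β ^ 4 * (q1 ^ 2 + 2 * q0 * q2) / 4)
    (e3 - β ^ 4 * (2 * q1 * q2) / 4) (e4 - β ^ 4 * q2 ^ 2 / 4)
  have hG2 : ∀ v, G v = α * (v 2 ^ 2 + β ^ 4 / 2 * (q0 * v 0 ^ 2 + q1 * v 0 * v 1 + q2 * v 1 ^ 2)) *
      (v 2 ^ 2 + β ^ 4 / 2 * (q0 * v 0 ^ 2 + q1 * v 0 * v 1 + q2 * v 1 ^ 2)) +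
      (a1 * v 0 + b1 * v 1) * ((a2 * v 0 + b2 * v 1) * (a3 * v 0 + b3 * v 1)
        * (a4 * v 0 + b4 * v 1)) := by
    intro v
    have := hf (v 0) (v 1)
    rw [hG]
    linear_combination this - (v 2 ^ 2 * (q0 * v 0 ^ 2 + q1 * v 0 * v 1 + q2 * v 1 ^ 2)
      + β ^ 4 / 4 * (q0 * v 0 ^ 2 + q1 * v 0 * v 1 + q2 * v 1 ^ 2) ^ 2) * hβα
  have hδ : a1 * b2 - a2 * b1 ≠ 0 := by
    intro hδ
    obtain ⟨x0, y0, hxy, hl1, hl2⟩ : ∃ x0 y0 : ℂ, (x0 ≠ 0 ∨ y0 ≠ 0) ∧ a1 * x0 + b1 * y0 = 0 ∧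
        a2 * x0 + b2 * y0 = 0 := by
      by_cases h1 : a1 = 0 ∧ b1 = 0
      · by_cases h2 : a2 = 0 ∧ b2 = 0
        · exact ⟨1, 0, by simp, by simp [h1], by simp [h2]⟩
        · exact ⟨b2, -a2, by simp; tauto, by simp [h1], by ring⟩
      · exact ⟨b1, -a1, by simp; tauto, by ring, by linear_combination -hδ⟩
    obtain ⟨z0, hz0⟩ := IsAlgClosed.exists_pow_nat_eq
      (-(β ^ 4 / 2 * (q0 * x0 ^ 2 + q1 * x0 * y0 + q2 * y0 ^ 2))) (n := 2) (by norm_num)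
    have hs : SingAt G ![x0, y0, z0] := by
      intro v
      simp only [hG2]
      have : (0 : ℂ) = 0 + 0 := by simp
      rw [show HasDerivAt _ (0 : ℂ) (0 : ℂ) ↔ HasDerivAt _ (0 + 0 : ℂ) (0 : ℂ) by rw [add_zero]]
      apply HasDerivAt.fun_add
      · apply hasDerivAt_prod_zero
        · simp; fun_prop
        · simp; fun_prop
        · simp [hz0]
        · simp [hz0]
      · apply hasDerivAt_prod_zero
        · simp; fun_prop
        · simp; fun_prop
        · simp [hl1]
        · simp [hl2]
    have h0 := hsm _ hs
    have h1 := congrFun h0 0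
    have h2 := congrFun h0 1
    simp at h1 h2
    tauto
  set δ := a1 * b2 - a2 * b1 with hδdef
  refine ⟨!![b2 / δ, -b1 / δ, 0; -a2 / δ, a1 / δ, 0; 0, 0, β],
    -(β ^ 2 / 2 * (q0 * (b2 / δ) ^ 2 + q1 * (b2 / δ) * (-a2 / δ) + q2 * (-a2 / δ) ^ 2)),
    -(β ^ 2 / 2 * (q0 * (2 * (b2 / δ) * (-b1 / δ)) + q1 * ((b2 / δ) * (a1 / δ) + (-b1 / δ) * (-a2 / δ))
      + q2 * (2 * (-a2 / δ) * (a1 / δ)))),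
    -(β ^ 2 / 2 * (q0 * (-b1 / δ) ^ 2 + q1 * (-b1 / δ) * (a1 / δ) + q2 * (a1 / δ) ^ 2)),
    -(1 / 4) * (a3 * (b2 / δ) + b3 * (-a2 / δ)), -(1 / 4) * (a3 * (-b1 / δ) + b3 * (a1 / δ)),
    a4 * (b2 / δ) + b4 * (-a2 / δ), a4 * (-b1 / δ) + b4 * (a1 / δ), ?_, ?_⟩
  · rw [isUnit_iff_ne_zero, Matrix.det_fin_three]
    simp
    have : b2 / δ * (a1 / δ) * β - -b1 / δ * (-a2 / δ) * β = β / δ := by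
      field_simp
      rw [hδdef]; ring
    rw [this]
    exact div_ne_zero hβ0 hδ
  · intro v
    have e1 : a1 * (b2 / δ * v 0 + -b1 / δ * v 1) + b1 * (-a2 / δ * v 0 + a1 / δ * v 1) = v 0 := by
      field_simp
      rw [hδdef]; ring
    have e2 : a2 * (b2 / δ * v 0 + -b1 / δ * v 1) + b2 * (-a2 / δ * v 0 + a1 / δ * v 1) = v 1 := by
      field_simp
      rw [hδdef]; ring
    have c0 : (!![b2 / δ, -b1 / δ, 0; -a2 / δ, a1 / δ, 0; 0, 0, β] *ᵥ v) 0 =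
      b2 / δ * v 0 + -b1 / δ * v 1 := by
      simp [Matrix.mulVec, dotProduct, Fin.sum_univ_three]
    have c1 : (!![b2 / δ, -b1 / δ, 0; -a2 / δ, a1 / δ, 0; 0, 0, β] *ᵥ v) 1 =
      -a2 / δ * v 0 + a1 / δ * v 1 := by
      simp [Matrix.mulVec, dotProduct, Fin.sum_univ_three]
    have c2 : (!![b2 / δ, -b1 / δ, 0; -a2 / δ, a1 / δ, 0; 0, 0, β] *ᵥ v) 2 = β * v 2 := by
      simp [Matrix.mulVec, dotProduct, Fin.sum_univ_three]
    rw [hG2, c0, c1, c2, e1, e2]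
    generalize b2 / δ = B2 at *
    generalize -b1 / δ = B1 at *
    generalize -a2 / δ = A2 at *
    generalize a1 / δ = A1 at *
    linear_combination (v 2 ^ 2 + β ^ 2 / 2 * (q0 * (B2 * v 0 + B1 * v 1) ^ 2 +
      q1 * (B2 * v 0 + B1 * v 1) * (A2 * v 0 + A1 * v 1) + q2 * (A2 * v 0 + A1 * v 1) ^ 2)) ^ 2 * hβα

lemma forward_s13 (g : MvPolynomial (Fin 3) ℂ) (hg : g.IsHomogeneous 4)
    (hsm : ∀ a, SingAt (fun v => eval v g) a → a = 0)
    (A : Matrix (Fin 3) (Fin 3) ℂ) (hA : IsUnit A.det)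
    (hns : ¬ ∃ c : ℂ, A = c • (1 : Matrix (Fin 3) (Fin 3) ℂ)) (c : ℂ)
    (hc : A * A = c • (1 : Matrix (Fin 3) (Fin 3) ℂ))
    (hinv : ∀ v, eval (A *ᵥ v) g = eval v g) :
    ∃ (T : Matrix (Fin 3) (Fin 3) ℂ) (r0 r1 r2 a b c d : ℂ), IsUnit T.det ∧ ∀ v : Fin 3 → ℂ,
      eval (T *ᵥ v) g = (v 2 ^ 2 - (r0 * v 0 ^ 2 + r1 * (v 0 * v 1) + r2 * v 1 ^ 2)) ^ 2
        - 4 * v 0 * v 1 * (a * v 0 + b * v 1) * (c * v 0 + d * v 1) := by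
  obtain ⟨s, hs⟩ := IsAlgClosed.exists_pow_nat_eq c (n := 2) (by norm_num)
  have hc0 : c ≠ 0 := by
    rintro rfl
    have := congrArg Matrix.det hc
    simp at this
    simp [this] at hA
  have hs0 : s ≠ 0 := by rintro rfl; simp at hs; exact hc0 hs.symm
  obtain ⟨e, P, he, hP, hBP⟩ := invol_diag' (s⁻¹ • A) (by
      simp only [Matrix.smul_mul, Matrix.mul_smul, hc, smul_smul, ← hs]
      rw [show s⁻¹ * (s⁻¹ * s ^ 2) = 1 by field_simp, one_smul]) (by
      intro h
      exact hns ⟨s, by rw [← h, smul_smul, mul_inv_cancel₀ hs0, one_smul]⟩) (by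
      intro h
      exact hns ⟨-s, by rw [neg_smul, ← smul_neg, ← h, smul_smul, mul_inv_cancel₀ hs0, one_smul]⟩)
  set D : Matrix (Fin 3) (Fin 3) ℂ := !![1,0,0;0,1,0;0,0,-1] with hD
  set G : (Fin 3 → ℂ) → ℂ := fun v => eval (P *ᵥ v) g with hGdef
  have hGsm : ∀ a, SingAt G a → a = 0 := by
    intro a ha
    have h1 := hsm _ (SingAt.comp P hP ha)
    have := congrArg (fun w => P⁻¹ *ᵥ w) h1
    simpa [Matrix.mulVec_mulVec, Matrix.nonsing_inv_mul P hP] using this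
  have hGD : ∀ v, G (D *ᵥ v) = (s⁻¹) ^ 4 * G v := by
    intro v
    simp only [hGdef]
    rw [Matrix.mulVec_mulVec, ← hBP, ← Matrix.mulVec_mulVec, Matrix.smul_mulVec,
      Matrix.smul_mulVec, homog_eval g hg, homog_eval g hg, hinv, he, one_mul]
  have hDD : ∀ v : Fin 3 → ℂ, D *ᵥ (D *ᵥ v) = v := by
    intro v
    ext i
    fin_cases i <;> simp [hD, Matrix.mulVec, dotProduct, Fin.sum_univ_three]
  obtain ⟨C, hC⟩ := quartic_form (aeval (fun i => ∑ j, MvPolynomial.C (P i j) * X j) g) (by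
    have := hg.aeval (n := 1) (fun i => ∑ j, MvPolynomial.C (P i j) * X j) (fun i =>
      IsHomogeneous.sum _ _ _ (fun j _ => by
        simpa using (isHomogeneous_C (Fin 3) (P i j)).mul (isHomogeneous_X ℂ j)))
    simpa using this)
  simp only [eval_subst] at hC
  have hCG : ∀ v, G v = _ := hC
  have d0 : ∀ v : Fin 3 → ℂ, (D *ᵥ v) 0 = v 0 := fun v => by
    simp [hD, Matrix.mulVec, dotProduct, Fin.sum_univ_three]
  have d1 : ∀ v : Fin 3 → ℂ, (D *ᵥ v) 1 = v 1 := fun v => by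
    simp [hD, Matrix.mulVec, dotProduct, Fin.sum_univ_three]
  have d2 : ∀ v : Fin 3 → ℂ, (D *ᵥ v) 2 = - v 2 := fun v => by
    simp [hD, Matrix.mulVec, dotProduct, Fin.sum_univ_three]
  have hk : s⁻¹ ^ 4 = 1 ∨ s⁻¹ ^ 4 = -1 := by
    by_contra hk
    have hk2 : (s⁻¹ ^ 4) ^ 2 ≠ 1 := by
      intro h
      exact hk (by
        rcases mul_eq_zero.mp (show (s⁻¹ ^ 4 - 1) * (s⁻¹ ^ 4 + 1) = 0 by linear_combination h) with h | h
        · exact Or.inl (sub_eq_zero.mp h)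
        · exact Or.inr (eq_neg_of_add_eq_zero_left h))
    have hz : ∀ v, G v = 0 := by
      intro v
      have h1 := hGD (D *ᵥ v)
      rw [hDD, hGD] at h1
      by_contra h0
      apply hk2
      apply mul_right_cancel₀ h0
      linear_combination -h1
    have := congrFun (hGsm ![1, 0, 0] (fun v => by
      simpa only [hz] using hasDerivAt_const (0 : ℂ) (0 : ℂ))) 0
    simp at this
  rcases hk with hk | hk
  · obtain ⟨U, r0, r1, r2, a, b, c, d, hU, h⟩ := even_case G hGsm (C 0 0) (C 2 0) (C 1 1) (C 0 2)
      (C 4 0) (C 3 1) (C 2 2) (C 1 3) (C 0 4) (by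
        intro v
        have h1 := hGD v
        rw [hk, one_mul] at h1
        have h2 : G v = (G v + G (D *ᵥ v)) / 2 := by rw [h1]; ring
        rw [h2, hCG, hCG, d0, d1, d2]
        simp [Finset.sum_range_succ]
        ring)
    refine ⟨P * U, r0, r1, r2, a, b, c, d, ?_, ?_⟩
    · rw [Matrix.det_mul]; exact hP.mul hU
    · intro v
      rw [← h, ← Matrix.mulVec_mulVec]
  · exfalso
    obtain ⟨a, ha, hsa⟩ := odd_sing G (C 3 0) (C 2 1) (C 1 2) (C 0 3) (C 1 0) (C 0 1) (by
        intro v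
        have h1 := hGD v
        have h2 : G v = (G v - G (D *ᵥ v)) / 2 := by rw [h1, hk]; ring
        rw [h2, hCG, hCG, d0, d1, d2]
        simp [Finset.sum_range_succ]
        ring)
    exact ha (hGsm a hsa)

/-- A smooth psd ternary quartic has an automorphism of order 2 if and only if,
after a linear change of coordinates, `f = (z² − f₂(x,y))² − 4xy(ax+by)(cx+dy)`
for some binary quadratic form `f₂` and scalars `a, b, c, d ∈ ℂ`. -/
theorem order_two_automorphism_iff_normal_form
    (f : MvPolynomial (Fin 3) ℝ) (hhom : f.IsHomogeneous 4)
    (hsm : IsSmooth f) (hpsd : IsPsd f) :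
    HasOrder2Aut f ↔
      ∃ (T : Matrix (Fin 3) (Fin 3) ℂ) (f₂ : MvPolynomial (Fin 3) ℂ)
        (a b c d : ℂ), IsUnit T.det ∧
        f₂.IsHomogeneous 2 ∧ (∀ s ∈ f₂.support, s 2 = 0) ∧
        aeval (fun i => ∑ j, MvPolynomial.C (T i j) * X j) (map (algebraMap ℝ ℂ) f)
          = (X 2 ^ 2 - f₂) ^ 2 -
            4 * X 0 * X 1 * (MvPolynomial.C a * X 0 + MvPolynomial.C b * X 1) *
              (MvPolynomial.C c * X 0 + MvPolynomial.C d * X 1) := by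
  constructor
  · rintro ⟨A, hA, hns, ⟨c, hc⟩, hinv⟩
    obtain ⟨T, r0, r1, r2, a, b, c, d, hT, h⟩ := forward_s13 (map (algebraMap ℝ ℂ) f)
      (hhom.map _) (fun a ha => hsm a (fun i => ha.pderiv i)) A hA hns c hc (fun v => by
        rw [← eval_subst, hinv])
    refine ⟨T, MvPolynomial.C r0 * X 0 ^ 2 + MvPolynomial.C r1 * (X 0 * X 1)
      + MvPolynomial.C r2 * X 1 ^ 2, a, b, c, d, hT, ?_, ?_, ?_⟩
    · have hx := isHomogeneous_X ℂ (0 : Fin 3)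
      have hy := isHomogeneous_X ℂ (1 : Fin 3)
      refine ((?_ : IsHomogeneous _ 2).add ?_).add ?_
      · simpa using (isHomogeneous_C (Fin 3) r0).mul (hx.pow 2)
      · simpa using (isHomogeneous_C (Fin 3) r1).mul (hx.mul hy)
      · simpa using (isHomogeneous_C (Fin 3) r2).mul (hy.pow 2)
    · intro s hs
      have hvars : (2 : Fin 3) ∉ (MvPolynomial.C r0 * X 0 ^ 2 + MvPolynomial.C r1 * (X 0 * X 1)
          + MvPolynomial.C r2 * X 1 ^ 2 : MvPolynomial (Fin 3) ℂ).vars := by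
        intro hmem
        have hsub : (MvPolynomial.C r0 * X 0 ^ 2 + MvPolynomial.C r1 * (X 0 * X 1)
          + MvPolynomial.C r2 * X 1 ^ 2 : MvPolynomial (Fin 3) ℂ) ∈ supported ℂ ({0, 1} : Set (Fin 3)) := by
          have h0 : (X 0 : MvPolynomial (Fin 3) ℂ) ∈ supported ℂ ({0, 1} : Set (Fin 3)) := by simp
          have h1 : (X 1 : MvPolynomial (Fin 3) ℂ) ∈ supported ℂ ({0, 1} : Set (Fin 3)) := by simp
          have hC : ∀ r : ℂ, (MvPolynomial.C r : MvPolynomial (Fin 3) ℂ) ∈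
            supported ℂ ({0, 1} : Set (Fin 3)) := fun r => Subalgebra.algebraMap_mem _ r
          exact add_mem (add_mem (mul_mem (hC _) (pow_mem h0 _)) (mul_mem (hC _) (mul_mem h0 h1)))
            (mul_mem (hC _) (pow_mem h1 _))
        have := mem_supported.mp hsub hmem
        simp at this
      by_contra h0
      exact hvars (mem_vars 2 |>.mpr ⟨s, hs, by simpa using h0⟩)
    · apply MvPolynomial.funext
      intro v
      rw [eval_subst, h]
      simp
  · rintro ⟨T, f₂, a, b, c, d, hT, hf2, hsupp, h⟩
    set g := map (algebraMap ℝ ℂ) f with hg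
    set D : Matrix (Fin 3) (Fin 3) ℂ := !![1,0,0;0,1,0;0,0,-1] with hD
    have hDD : D * D = 1 := by
      ext i j
      fin_cases i <;> fin_cases j <;> simp [hD, Matrix.mul_apply, Fin.sum_univ_three]
    have hTi := Matrix.nonsing_inv_mul T hT
    have hTi' := Matrix.mul_nonsing_inv T hT
    have d0 : ∀ v : Fin 3 → ℂ, (D *ᵥ v) 0 = v 0 := fun v => by
      simp [hD, Matrix.mulVec, dotProduct, Fin.sum_univ_three]
    have d1 : ∀ v : Fin 3 → ℂ, (D *ᵥ v) 1 = v 1 := fun v => by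
      simp [hD, Matrix.mulVec, dotProduct, Fin.sum_univ_three]
    have d2 : ∀ v : Fin 3 → ℂ, (D *ᵥ v) 2 = - v 2 := fun v => by
      simp [hD, Matrix.mulVec, dotProduct, Fin.sum_univ_three]
    have hAA : (T * D * T⁻¹) * (T * D * T⁻¹) = 1 := by
      calc (T * D * T⁻¹) * (T * D * T⁻¹) = T * (D * (T⁻¹ * T) * D) * T⁻¹ := by
            simp only [Matrix.mul_assoc]
        _ = 1 := by rw [hTi, Matrix.mul_one, hDD, Matrix.mul_one, hTi']
    refine ⟨T * D * T⁻¹, ?_, ?_, ⟨1, by rw [hAA, one_smul]⟩, ?_⟩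
    · exact Matrix.isUnit_det_of_right_inverse hAA
    · rintro ⟨k, hk⟩
      have hDk : D = k • 1 := by
        calc D = (T⁻¹ * T) * D * (T⁻¹ * T) := by rw [hTi]; simp
          _ = T⁻¹ * (T * D * T⁻¹) * T := by simp only [Matrix.mul_assoc]
          _ = k • 1 := by rw [hk]; simp [hTi]
      have h0 := congrFun (congrFun hDk 0) 0
      have h2 := congrFun (congrFun hDk 2) 2
      simp [hD] at h0 h2
      rw [← h0] at h2
      norm_num at h2
    · have hF : ∀ v, eval (T *ᵥ v) g = (v 2 ^ 2 - eval v f₂) ^ 2 -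
          4 * v 0 * v 1 * (a * v 0 + b * v 1) * (c * v 0 + d * v 1) := by
        intro v
        rw [← eval_subst, h]
        simp
      have hf2D : ∀ v, eval (D *ᵥ v) f₂ = eval v f₂ := by
        intro v
        rw [eval_eq', eval_eq']
        apply Finset.sum_congr rfl
        intro s hs
        simp [Fin.prod_univ_three, d0, d1, hsupp s hs]
      apply MvPolynomial.funext
      intro v
      rw [eval_subst, ← Matrix.mulVec_mulVec, ← Matrix.mulVec_mulVec, hF, hf2D, d0, d1, d2]
      have := hF (T⁻¹ *ᵥ v)
      rw [Matrix.mulVec_mulVec, hTi', Matrix.one_mulVec] at this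
      rw [this]
      ring
end
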